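/- arXiv:2010.01731 — 4 statements merged into one kernel-verified Lean document; each statement's English description precedes it below -/
import Mathlib

section
/- For every integer N ≥ 1, one has π(x) − ∑_{n=1}^{N} (μ(n)/n)·Π(x^{1/n}) = o(Π(x^{1/N})) as x → ∞; that is, π(x) has the asymptotic expansion π(x) ∼ ∑_{n=1}^∞ (μ(n)/n)·Π(x^{1/n}) as x → ∞. -/
open Filter

/-- The prime counting function `π(x)`: the number of primes `p ≤ x`. -/
noncomputable def primePi (x : ℝ) : ℝ := Nat.primeCounting ⌊x⌋₊

/-- The Riemann prime counting function `Π(x) = ∑_{n=1}^∞ (1/n)·π(x^{1/n})`. -/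
noncomputable def riemannPi (x : ℝ) : ℝ :=
  ∑' n : ℕ, (1 / (n + 1 : ℝ)) * primePi (x ^ (1 / (n + 1 : ℝ)))

open Asymptotics

lemma primePi_nonneg (x : ℝ) : 0 ≤ primePi x := Nat.cast_nonneg _

lemma primePi_le_self {x : ℝ} (hx : 0 ≤ x) : primePi x ≤ x := by
  refine le_trans ?_ (Nat.floor_le hx)
  unfold primePi
  rw [← Nat.primesLE_card_eq_primeCounting, Nat.primesLE_eq_filter_Ioc_zero]
  exact_mod_cast (Finset.card_filter_le _ _).trans (by simp)

lemma primePi_eq_zero_of_lt_two {x : ℝ} (hx : x < 2) : primePi x = 0 := by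
  have h : ⌊x⌋₊ < 2 := (Nat.floor_lt' two_ne_zero).2 (by exact_mod_cast hx)
  rw [primePi, Nat.cast_eq_zero, Nat.primeCounting_eq_zero_iff]
  omega

lemma riemannPi_summand_nonneg (x : ℝ) (k : ℕ) :
    0 ≤ (1 / (k + 1 : ℝ)) * primePi (x ^ (1 / (k + 1 : ℝ))) :=
  mul_nonneg (by positivity) (primePi_nonneg _)

lemma riemannPi_eq_sum_range {x : ℝ} (hx : 1 ≤ x) {M : ℕ} (hM : x < 2 ^ (M + 1)) :
    riemannPi x =
      ∑ k ∈ Finset.range M, (1 / (k + 1 : ℝ)) * primePi (x ^ (1 / (k + 1 : ℝ))) := by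
  refine tsum_eq_sum fun k hk => ?_
  rw [Finset.mem_range, not_lt] at hk
  rw [primePi_eq_zero_of_lt_two, mul_zero]
  rw [one_div, Real.rpow_inv_lt_iff_of_pos (by linarith) zero_le_two (by positivity)]
  have : (2 : ℝ) ^ (M + 1) ≤ 2 ^ (k + 1) := by
    gcongr
    norm_num
  exact_mod_cast hM.trans_le this

lemma lt_two_pow_add_floor_logb {x : ℝ} (hx : 1 ≤ x) (K : ℕ) :
    x < 2 ^ (K + ⌊Real.logb 2 x⌋₊ + 1) := by
  have h : Real.logb 2 x < (K + ⌊Real.logb 2 x⌋₊ + 1 : ℕ) := by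
    push_cast
    linarith [Nat.lt_floor_add_one (Real.logb 2 x), (Nat.cast_nonneg K : (0 : ℝ) ≤ K)]
  rwa [Real.logb_lt_iff_lt_rpow one_lt_two (by linarith), Real.rpow_natCast] at h

lemma primePi_le_riemannPi {x : ℝ} (hx : 1 ≤ x) : primePi x ≤ riemannPi x := by
  rw [riemannPi_eq_sum_range hx (lt_two_pow_add_floor_logb hx 1)]
  refine le_trans ?_ (Finset.single_le_sum (fun k _ => riemannPi_summand_nonneg x k)
    (Finset.mem_range.2 (by omega : 0 < 1 + ⌊Real.logb 2 x⌋₊)))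
  simp

lemma abs_riemannPi_sub_sum_range_le {x : ℝ} (hx : 1 ≤ x) (K : ℕ) :
    |riemannPi x -
        ∑ k ∈ Finset.range K, (1 / (k + 1 : ℝ)) * primePi (x ^ (1 / (k + 1 : ℝ)))| ≤
      Real.logb 2 x * x ^ (1 / (K + 1 : ℝ)) := by
  rw [riemannPi_eq_sum_range hx (lt_two_pow_add_floor_logb hx K), Finset.sum_range_add,
    add_sub_cancel_left, abs_of_nonneg (Finset.sum_nonneg fun _ _ => riemannPi_summand_nonneg x _)]
  calc
    _ ≤ ∑ j ∈ Finset.range ⌊Real.logb 2 x⌋₊, x ^ (1 / (K + 1 : ℝ)) := by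
      refine Finset.sum_le_sum fun j _ => ?_
      have h1 : (1 / (((K + j : ℕ) : ℝ) + 1)) ≤ 1 := by
        rw [div_le_one (by positivity)]
        linarith [(Nat.cast_nonneg (K + j) : (0 : ℝ) ≤ (K + j : ℕ))]
      refine (mul_le_of_le_one_left (primePi_nonneg _) h1).trans ?_
      refine (primePi_le_self (by positivity)).trans ?_
      refine Real.rpow_le_rpow_of_exponent_le hx ?_
      gcongr
      omega
    _ = ⌊Real.logb 2 x⌋₊ * x ^ (1 / (K + 1 : ℝ)) := by simp
    _ ≤ _ := by
      gcongr
      exact Nat.floor_le (Real.logb_nonneg one_lt_two hx)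

lemma riemannPi_sub_sum_range_isLittleO (K : ℕ) {s : ℝ} (hs : 1 / (K + 1 : ℝ) < s) :
    (fun x : ℝ => riemannPi x -
        ∑ k ∈ Finset.range K, (1 / (k + 1 : ℝ)) * primePi (x ^ (1 / (k + 1 : ℝ))))
      =o[atTop] fun x : ℝ => x ^ s := by
  have hbound : (fun x : ℝ => riemannPi x -
        ∑ k ∈ Finset.range K, (1 / (k + 1 : ℝ)) * primePi (x ^ (1 / (k + 1 : ℝ))))
      =O[atTop] fun x : ℝ => Real.log x * x ^ (1 / (K + 1 : ℝ)) := by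
    refine IsBigO.of_bound (Real.log 2)⁻¹ ?_
    filter_upwards [eventually_ge_atTop 1] with x hx
    refine (abs_riemannPi_sub_sum_range_le hx K).trans ?_
    rw [Real.norm_of_nonneg (mul_nonneg (Real.log_nonneg hx) (by positivity)), Real.logb,
      div_eq_inv_mul, mul_assoc]
  refine hbound.trans_isLittleO ?_
  refine ((isLittleO_log_rpow_atTop (sub_pos.2 hs)).mul_isBigO
    (isBigO_refl (fun x : ℝ => x ^ (1 / (K + 1 : ℝ))) atTop)).congr' EventuallyEq.rfl ?_
  filter_upwards [eventually_gt_atTop 0] with x hx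
  rw [← Real.rpow_add hx, sub_add_cancel]

lemma rpow_isBigO_primePi {r : ℝ} (hr : r < 1) :
    (fun x : ℝ => x ^ r) =O[atTop] primePi := by
  have hlin : ∀ᶠ x : ℝ in atTop, x * (Real.log 2 / 4) ≤
      (x - 1) * Real.log 2 - Real.log (x + 2) := by
    have h2 : 0 < Real.log 2 := Real.log_pos one_lt_two
    have hlog := (Real.isLittleO_log_id_atTop.comp_tendsto
      (tendsto_atTop_add_const_right atTop (2 : ℝ) tendsto_id)).bound
        (show 0 < Real.log 2 / 4 by positivity)
    filter_upwards [hlog, eventually_ge_atTop 4] with x hx hx4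
    simp only [Function.comp_apply, id_eq, Real.norm_eq_abs] at hx
    rw [abs_of_nonneg (by linarith : 0 ≤ x + 2)] at hx
    have := le_abs_self (Real.log (x + 2))
    nlinarith
  have hlog := (isLittleO_log_rpow_atTop (sub_pos.2 hr)).bound one_pos
  refine IsBigO.of_bound (4 / Real.log 2) ?_
  filter_upwards [hlin, hlog, eventually_gt_atTop 1] with x hx hl hx1
  have hx0 : 0 < x := by linarith
  have hlx : 0 < Real.log x := Real.log_pos hx1
  have h2 : 0 < Real.log 2 := Real.log_pos one_lt_two
  have hπ := Chebyshev.pi_ge' hx1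
  rw [div_le_iff₀ hlx] at hπ
  rw [Real.norm_of_nonneg (by positivity), Real.norm_of_nonneg (by positivity), one_mul] at hl
  rw [Real.norm_of_nonneg (by positivity), Real.norm_of_nonneg (primePi_nonneg x)]
  have hmul : x ^ r * Real.log x ≤ x := by
    calc x ^ r * Real.log x ≤ x ^ r * x ^ (1 - r) := by gcongr
      _ = x := by rw [← Real.rpow_add hx0]; simp
  have hchain : x * (Real.log 2 / 4) ≤ primePi x * Real.log x := hx.trans hπ
  refine le_of_mul_le_mul_right ?_ hlx
  calc x ^ r * Real.log x ≤ x := hmul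
    _ = 4 / Real.log 2 * (x * (Real.log 2 / 4)) := by field_simp
    _ ≤ 4 / Real.log 2 * (primePi x * Real.log x) := by gcongr
    _ = _ := by ring

lemma rpow_isBigO_riemannPi {r : ℝ} (hr : r < 1) :
    (fun x : ℝ => x ^ r) =O[atTop] riemannPi := by
  refine (rpow_isBigO_primePi hr).trans (IsBigO.of_bound 1 ?_)
  filter_upwards [eventually_ge_atTop 1] with x hx
  rw [one_mul, Real.norm_of_nonneg (primePi_nonneg x)]
  exact (primePi_le_riemannPi hx).trans (le_abs_self _)

lemma sum_moebius_mul_sum_Icc_div {N : ℕ} (hN : 1 ≤ N) (g : ℕ → ℝ) :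
    ∑ n ∈ Finset.Icc 1 N, (ArithmeticFunction.moebius n : ℝ) *
      ∑ k ∈ Finset.Icc 1 (N / n), g (n * k) = g 1 := by
  have hdiv (m : ℕ) : ∑ p ∈ m.divisorsAntidiagonal, (ArithmeticFunction.moebius p.1 : ℝ) =
      if m = 1 then 1 else 0 := by
    rw [Nat.sum_divisorsAntidiagonal (fun d _ => (ArithmeticFunction.moebius d : ℝ)),
      ← ArithmeticFunction.one_apply, ← ArithmeticFunction.coe_moebius_mul_coe_zeta,
      ArithmeticFunction.coe_mul_zeta_apply]
    rfl
  calc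
    _ = ∑ m ∈ Finset.Icc 1 N, ∑ p ∈ m.divisorsAntidiagonal,
        (ArithmeticFunction.moebius p.1 : ℝ) * g m := by
      simp_rw [Finset.mul_sum]
      rw [Finset.sum_sigma', Finset.sum_sigma']
      refine Finset.sum_bij' (fun a _ => ⟨a.1 * a.2, (a.1, a.2)⟩)
        (fun b _ => ⟨b.2.1, b.2.2⟩) ?_ ?_ ?_ ?_ ?_
      · rintro ⟨n, k⟩ h
        simp only [Finset.mem_sigma, Finset.mem_Icc, Nat.mem_divisorsAntidiagonal] at h ⊢
        have hnk : 0 < n * k := Nat.mul_pos h.1.1 h.2.1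
        have hle := (Nat.le_div_iff_mul_le h.1.1).1 h.2.2
        exact ⟨⟨hnk, by rwa [mul_comm]⟩, trivial, hnk.ne'⟩
      · rintro ⟨m, n, k⟩ h
        simp only [Finset.mem_sigma, Finset.mem_Icc, Nat.mem_divisorsAntidiagonal] at h ⊢
        obtain ⟨⟨-, hmN⟩, rfl, h0⟩ := h
        have hn := Nat.pos_of_ne_zero (left_ne_zero_of_mul h0)
        have hk := Nat.pos_of_ne_zero (right_ne_zero_of_mul h0)
        exact ⟨⟨hn, (Nat.le_mul_of_pos_right n hk).trans hmN⟩, hk,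
          (Nat.le_div_iff_mul_le hn).2 (by rwa [mul_comm])⟩
      · simp
      · rintro ⟨m, n, k⟩ h
        simp only [Finset.mem_sigma, Nat.mem_divisorsAntidiagonal] at h
        obtain ⟨-, rfl, -⟩ := h
        rfl
      · simp
    _ = g 1 := by
      simp_rw [← Finset.sum_mul, hdiv, ite_mul, one_mul, zero_mul]
      simp [hN]

lemma sum_moebius_div_mul_primePi {N : ℕ} (hN : 1 ≤ N) {x : ℝ} (hx : 0 ≤ x) :
    ∑ n ∈ Finset.Icc 1 N, ((ArithmeticFunction.moebius n : ℝ) / n) *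
      ∑ k ∈ Finset.range (N / n), (1 / (k + 1 : ℝ)) *
        primePi ((x ^ (1 / (n : ℝ))) ^ (1 / (k + 1 : ℝ))) = primePi x := by
  have h := sum_moebius_mul_sum_Icc_div hN
    (fun m => (1 / (m : ℝ)) * primePi (x ^ (1 / (m : ℝ))))
  simp only [Nat.cast_one, div_one, one_mul, Real.rpow_one] at h
  rw [← h]
  refine Finset.sum_congr rfl fun n _ => ?_
  rw [div_mul_eq_mul_div, mul_div_assoc, Finset.sum_div]
  congr 1
  refine Finset.sum_bij' (fun k _ => k + 1) (fun k _ => k - 1) ?_ ?_ ?_ ?_ ?_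
  · intro k hk
    simp only [Finset.mem_range, Finset.mem_Icc] at hk ⊢
    omega
  · intro k hk
    simp only [Finset.mem_range, Finset.mem_Icc] at hk ⊢
    omega
  · simp
  · intro k hk
    simp only [Finset.mem_Icc] at hk
    omega
  · intro k _
    push_cast
    rw [← Real.rpow_mul hx, one_div_mul_one_div, mul_div_right_comm, div_div,
      mul_comm (k + 1 : ℝ)]

/-- For every integer `N ≥ 1`, one has
`π(x) − ∑_{n=1}^{N} (μ(n)/n)·Π(x^{1/n}) = o(Π(x^{1/N}))` as `x → ∞`. -/
theorem primePi_moebius_asymptotic_expansion (N : ℕ) (hN : 1 ≤ N) :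
    (fun x : ℝ =>
        primePi x - ∑ n ∈ Finset.Icc 1 N,
          ((ArithmeticFunction.moebius n : ℝ) / n) * riemannPi (x ^ (1 / (n : ℝ))))
      =o[atTop] fun x : ℝ => riemannPi (x ^ (1 / (N : ℝ))) := by
  have hN0 : (0 : ℝ) < N := by exact_mod_cast hN
  obtain ⟨t, ht1, ht2⟩ : ∃ t : ℝ, 1 / (N + 1 : ℝ) < t ∧ t < 1 / (N : ℝ) :=
    exists_between (one_div_lt_one_div_of_lt hN0 (by linarith))
  have hroot {n : ℕ} (hn : 1 ≤ n) : Tendsto (fun x : ℝ => x ^ (1 / (n : ℝ))) atTop atTop :=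
    tendsto_rpow_atTop (one_div_pos.2 (by exact_mod_cast hn))
  have hlower : (fun x : ℝ => x ^ t) =O[atTop] fun x : ℝ => riemannPi (x ^ (1 / (N : ℝ))) := by
    have htN : t * N < 1 := (lt_div_iff₀ hN0).1 ht2
    refine ((rpow_isBigO_riemannPi htN).comp_tendsto (hroot hN)).congr' ?_ EventuallyEq.rfl
    filter_upwards [eventually_ge_atTop 0] with x hx
    rw [Function.comp_apply, ← Real.rpow_mul hx]
    congr 1
    field_simp
  refine IsLittleO.trans_isBigO ?_ hlower
  have hterm (n : ℕ) (hn : n ∈ Finset.Icc 1 N) :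
      (fun x : ℝ => ((ArithmeticFunction.moebius n : ℝ) / n) *
        (riemannPi (x ^ (1 / (n : ℝ))) - ∑ k ∈ Finset.range (N / n), (1 / (k + 1 : ℝ)) *
          primePi ((x ^ (1 / (n : ℝ))) ^ (1 / (k + 1 : ℝ))))) =o[atTop] fun x : ℝ => x ^ t := by
    obtain ⟨hn1, -⟩ := Finset.mem_Icc.1 hn
    have hn0 : (0 : ℝ) < n := by exact_mod_cast hn1
    have hs : 1 / ((N / n : ℕ) + 1 : ℝ) < n * t := by
      have hlt : (N + 1 : ℝ) ≤ n * ((N / n : ℕ) + 1) := by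
        exact_mod_cast Nat.lt_mul_div_succ N hn1
      refine lt_of_le_of_lt ?_ ((mul_lt_mul_iff_right₀ hn0).2 ht1)
      rw [mul_one_div, div_le_div_iff₀ (by positivity) (by positivity)]
      linarith
    refine (((riemannPi_sub_sum_range_isLittleO (N / n) hs).comp_tendsto
      (hroot hn1)).const_mul_left _).congr' EventuallyEq.rfl ?_
    filter_upwards [eventually_ge_atTop 0] with x hx
    rw [Function.comp_apply, ← Real.rpow_mul hx]
    congr 1
    field_simp
  refine (IsLittleO.sum hterm).neg_left.congr' ?_ EventuallyEq.rfl
  filter_upwards [eventually_ge_atTop 0] with x hx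
  simp only [Finset.sum_apply, mul_sub, Finset.sum_sub_distrib, sum_moebius_div_mul_primePi hN hx]
  ring
end

section
/- One has Ri(x) = R(x) + O((log log x)²) as x → ∞, where R(x) := ∑_{n ≤ log x} (μ(n)/n)·li(x^{1/n}); that is, there exist constants C and x₀ > e such that |Ri(x) − ∑_{1 ≤ n ≤ log x} (μ(n)/n)·li(x^{1/n})| ≤ C·(log log x)² for all x ≥ x₀. -/
open Filter

/-- `ζ(k) = ∑_{n=1}^∞ 1/n^k` for a natural number `k` (real-valued). -/
noncomputable def realZeta (k : ℕ) : ℝ := ∑' n : ℕ, 1 / ((n : ℝ) + 1) ^ k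

/-- The logarithmic integral, via the series
`li(x) = γ + log log x + ∑_{k=1}^∞ (log x)^k/(k·k!)` (valid for `x > 1`). -/
noncomputable def li (x : ℝ) : ℝ :=
  Real.eulerMascheroniConstant + Real.log (Real.log x) +
    ∑' k : ℕ, (Real.log x) ^ (k + 1) / (((k : ℝ) + 1) * (Nat.factorial (k + 1) : ℝ))

/-- Riemann's function, via the Gram series
`Ri(x) = 1 + ∑_{k=1}^∞ (log x)^k/(k·k!·ζ(k+1))` (valid for `x > 1`). -/
noncomputable def Ri (x : ℝ) : ℝ :=
  1 + ∑' k : ℕ,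
    (Real.log x) ^ (k + 1) / (((k : ℝ) + 1) * (Nat.factorial (k + 1) : ℝ) * realZeta (k + 2))

open ArithmeticFunction in
/-- `1 / ζ(k) = ∑ μ(n) / n ^ k` for natural numbers `k ≥ 2`. -/
theorem inv_realZeta_eq_tsum_moebius {k : ℕ} (hk : 2 ≤ k) :
    (realZeta k)⁻¹ = ∑' n : ℕ, (moebius n : ℝ) / (n : ℝ) ^ k := by
  have hs : 1 < (k : ℂ).re := by
    rw [Complex.natCast_re]
    exact_mod_cast hk
  have hzeta : LSeries (fun n ↦ ((zeta n : ℕ) : ℂ)) k = (realZeta k : ℂ) := by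
    rw [LSeries_zeta_eq_riemannZeta hs, zeta_eq_tsum_one_div_nat_add_one_cpow hs, realZeta,
      Complex.ofReal_tsum]
    refine tsum_congr fun n ↦ ?_
    rw [Complex.cpow_natCast]
    push_cast
    rfl
  have hmoebius : LSeries (fun n ↦ ((moebius n : ℤ) : ℂ)) k =
      ((∑' n : ℕ, (moebius n : ℝ) / (n : ℝ) ^ k : ℝ) : ℂ) := by
    rw [LSeries, Complex.ofReal_tsum]
    refine tsum_congr fun n ↦ ?_
    rcases eq_or_ne n 0 with rfl | hn
    · simp
    · rw [LSeries.term_of_ne_zero hn, Complex.cpow_natCast]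
      push_cast
      rfl
  have h := LSeries_zeta_mul_Lseries_moebius hs
  rw [hzeta, hmoebius] at h
  exact inv_eq_of_mul_eq_one_right (by exact_mod_cast h)

/-- The entire exponential integral `∑_{k ≥ 1} y ^ k / (k · k!)`. -/
noncomputable def ein (y : ℝ) : ℝ :=
  ∑' k : ℕ, y ^ (k + 1) / (((k : ℝ) + 1) * (Nat.factorial (k + 1) : ℝ))

theorem summable_ein {y : ℝ} (hy : 0 ≤ y) :
    Summable fun k : ℕ ↦ y ^ (k + 1) / (((k : ℝ) + 1) * (Nat.factorial (k + 1) : ℝ)) := by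
  refine Summable.of_nonneg_of_le (fun k ↦ by positivity) (fun k ↦ ?_)
    ((summable_nat_add_iff 1).mpr (Real.summable_pow_div_factorial y))
  gcongr
  exact le_mul_of_one_le_left (by positivity) (by linarith [k.cast_nonneg (α := ℝ)])

theorem ein_nonneg {y : ℝ} (hy : 0 ≤ y) : 0 ≤ ein y :=
  tsum_nonneg fun k ↦ by positivity

theorem ein_le_mul {y : ℝ} (hy : 0 ≤ y) (hy1 : y ≤ 1) : ein y ≤ y * ein 1 := by
  rw [ein, ein, ← tsum_mul_left]
  refine (summable_ein hy).tsum_le_tsum (fun k ↦ ?_) ((summable_ein zero_le_one).mul_left y)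
  rw [one_pow, mul_one_div]
  gcongr
  rw [pow_succ]
  exact mul_le_of_le_one_left hy (pow_le_one₀ hy hy1)

theorem abs_moebius_le_one_real (n : ℕ) : |(ArithmeticFunction.moebius n : ℝ)| ≤ 1 := by
  exact_mod_cast ArithmeticFunction.abs_moebius_le_one (n := n)

theorem summable_moebius_gram {y : ℝ} (hy : 0 ≤ y) :
    Summable (Function.uncurry fun k n : ℕ ↦
      y ^ (k + 1) / (((k : ℝ) + 1) * (Nat.factorial (k + 1) : ℝ)) *
        ((ArithmeticFunction.moebius n : ℝ) / (n : ℝ) ^ (k + 2))) := by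
  have hsq : Summable fun n : ℕ ↦ 1 / (n : ℝ) ^ 2 := Real.summable_one_div_nat_pow.mpr one_lt_two
  refine Summable.of_norm_bounded
    ((summable_ein hy).mul_of_nonneg hsq (fun k ↦ by positivity) fun n ↦ by positivity) ?_
  rintro ⟨k, n⟩
  rw [Function.uncurry_apply_pair, norm_mul, norm_div (ArithmeticFunction.moebius n : ℝ),
    Real.norm_eq_abs, Real.norm_eq_abs, Real.norm_eq_abs, abs_of_nonneg (by positivity :
      0 ≤ y ^ (k + 1) / (((k : ℝ) + 1) * (Nat.factorial (k + 1) : ℝ)))]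
  rcases eq_or_ne n 0 with rfl | hn
  · simp
  · have hn1 : (1 : ℝ) ≤ n := by exact_mod_cast Nat.one_le_iff_ne_zero.mpr hn
    rw [abs_of_nonneg (by positivity : (0 : ℝ) ≤ (n : ℝ) ^ (k + 2))]
    gcongr
    · exact abs_moebius_le_one_real n
    · omega

theorem tsum_moebius_gram (y : ℝ) (n : ℕ) :
    ∑' k : ℕ, y ^ (k + 1) / (((k : ℝ) + 1) * (Nat.factorial (k + 1) : ℝ)) *
        ((ArithmeticFunction.moebius n : ℝ) / (n : ℝ) ^ (k + 2)) =
      (ArithmeticFunction.moebius n : ℝ) / n * ein (y / n) := by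
  rw [ein, ← tsum_mul_left]
  refine tsum_congr fun k ↦ ?_
  rw [div_pow, pow_succ (n : ℝ) (k + 1)]
  ring

/-- The Gram series regrouped as an absolutely convergent Möbius sum. -/
theorem Ri_eq_one_add_tsum {x : ℝ} (hx : 0 ≤ Real.log x) :
    Ri x = 1 + ∑' n : ℕ,
      (ArithmeticFunction.moebius n : ℝ) / n * ein (Real.log x / n) := by
  simp_rw [← tsum_moebius_gram, Ri]
  rw [(summable_moebius_gram hx).tsum_comm]
  congr 1
  refine tsum_congr fun k ↦ ?_
  rw [tsum_mul_left, ← inv_realZeta_eq_tsum_moebius (by omega), ← div_eq_mul_inv, div_div]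

theorem summable_moebius_mul_ein {y : ℝ} (hy : 0 ≤ y) :
    Summable fun n : ℕ ↦ (ArithmeticFunction.moebius n : ℝ) / n * ein (y / n) := by
  simp_rw [← tsum_moebius_gram]
  exact (summable_moebius_gram hy).prod_symm.prod

theorem li_rpow_one_div (x : ℝ) (hx : 0 < x) (n : ℕ) :
    li (x ^ (1 / (n : ℝ))) = Real.eulerMascheroniConstant + Real.log (Real.log x / n) +
      ein (Real.log x / n) := by
  rw [li, Real.log_rpow hx, one_div_mul_eq_div, ein]

theorem abs_tsum_moebius_mul_ein_tail_le {y : ℝ} (hy : 0 ≤ y) :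
    |∑' n : ℕ, (ArithmeticFunction.moebius (n + (⌊y⌋₊ + 1)) : ℝ) / (n + (⌊y⌋₊ + 1) : ℕ) *
      ein (y / (n + (⌊y⌋₊ + 1) : ℕ))| ≤ 2 * ein 1 := by
  set N := ⌊y⌋₊
  have hyN : y < N + 1 := Nat.lt_floor_add_one y
  have h1 := ein_nonneg zero_le_one
  have hterm (n : ℕ) : |(ArithmeticFunction.moebius (n + (N + 1)) : ℝ) / (n + (N + 1) : ℕ) *
      ein (y / (n + (N + 1) : ℕ))| ≤ y * ein 1 * (((n + (N + 1) : ℕ) : ℝ) ^ 2)⁻¹ := by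
    have hm : (0 : ℝ) < (n + (N + 1) : ℕ) := by positivity
    have hym : y / (n + (N + 1) : ℕ) ≤ 1 := by
      rw [div_le_one hm]
      push_cast
      linarith [n.cast_nonneg (α := ℝ)]
    have h0 : 0 ≤ y / (n + (N + 1) : ℕ) := by positivity
    rw [abs_mul, abs_div, abs_of_pos hm, abs_of_nonneg (ein_nonneg h0)]
    calc _ ≤ 1 / ((n + (N + 1) : ℕ) : ℝ) * (y / (n + (N + 1) : ℕ) * ein 1) := by
          gcongr
          · exact ein_nonneg h0
          · exact abs_moebius_le_one_real _
          · exact ein_le_mul h0 hym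
      _ = _ := by field_simp
  have hbound (M : ℕ) : ∑ n ∈ Finset.range M,
      y * ein 1 * (((n + (N + 1) : ℕ) : ℝ) ^ 2)⁻¹ ≤ 2 * ein 1 := by
    have hsum := sum_Ioo_inv_sq_le (α := ℝ) N (M + (N + 1))
    rw [← Finset.Ico_succ_left_eq_Ioo, Order.succ_eq_add_one,
      Finset.sum_Ico_eq_sum_range, Nat.add_sub_cancel] at hsum
    rw [← Finset.mul_sum]
    simp_rw [add_comm _ (N + 1)]
    calc _ ≤ y * ein 1 * (2 / (N + 1)) := by gcongr
      _ = y / (N + 1) * (2 * ein 1) := by ring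
      _ ≤ 2 * ein 1 :=
        mul_le_of_le_one_left (by positivity) ((div_le_one (by positivity)).mpr hyN.le)
  have hnonneg (n : ℕ) : 0 ≤ y * ein 1 * (((n + (N + 1) : ℕ) : ℝ) ^ 2)⁻¹ := by positivity
  rw [← Real.norm_eq_abs]
  exact (tsum_of_norm_bounded (summable_of_sum_range_le hnonneg hbound).hasSum hterm).trans
    (Real.tsum_le_of_sum_range_le hnonneg hbound)

theorem abs_sum_moebius_div_mul_log_le {y : ℝ} (hy : 1 ≤ y) :
    |∑ n ∈ Finset.Icc 1 ⌊y⌋₊, (ArithmeticFunction.moebius n : ℝ) / n *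
      (Real.eulerMascheroniConstant + Real.log (y / n))| ≤ (1 + Real.log y) ^ 2 := by
  have hlog := Real.log_nonneg hy
  calc _ ≤ ∑ n ∈ Finset.Icc 1 ⌊y⌋₊, ((n : ℝ)⁻¹ * (1 + Real.log y)) := by
        refine (Finset.abs_sum_le_sum_abs _ _).trans (Finset.sum_le_sum fun n hn ↦ ?_)
        obtain ⟨hn1, hnN⟩ := Finset.mem_Icc.mp hn
        have hn1' : (1 : ℝ) ≤ n := by exact_mod_cast hn1
        have hny : (n : ℝ) ≤ y := (Nat.le_floor_iff (by linarith)).mp hnN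
        have hpos : 0 ≤ Real.log (y / n) :=
          Real.log_nonneg ((one_le_div (by linarith)).mpr hny)
        have hle : Real.log (y / n) ≤ Real.log y :=
          Real.log_le_log (by positivity) (div_le_self (by linarith) hn1')
        have hγ := Real.eulerMascheroniConstant_lt_two_thirds
        have hγ' := Real.one_half_lt_eulerMascheroniConstant
        rw [abs_mul, abs_div, Nat.abs_cast, ← one_div,
          abs_of_nonneg (a := Real.eulerMascheroniConstant + _) (by linarith)]
        gcongr
        · exact abs_moebius_le_one_real n
        · linarith
    _ = (harmonic ⌊y⌋₊ : ℝ) * (1 + Real.log y) := by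
        rw [← Finset.sum_mul, harmonic_eq_sum_Icc]
        push_cast
        rfl
    _ ≤ (1 + Real.log y) * (1 + Real.log y) := by
        gcongr
        exact harmonic_floor_le_one_add_log y hy
    _ = _ := by ring

theorem Ri_sub_sum_moebius_mul_li_eq {x : ℝ} (hx : 1 ≤ x) :
    Ri x - ∑ n ∈ Finset.Icc 1 ⌊Real.log x⌋₊,
        ((ArithmeticFunction.moebius n : ℝ) / n) * li (x ^ (1 / (n : ℝ))) =
      1 + (∑' n : ℕ, (ArithmeticFunction.moebius (n + (⌊Real.log x⌋₊ + 1)) : ℝ) /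
          (n + (⌊Real.log x⌋₊ + 1) : ℕ) * ein (Real.log x / (n + (⌊Real.log x⌋₊ + 1) : ℕ))) -
        ∑ n ∈ Finset.Icc 1 ⌊Real.log x⌋₊, (ArithmeticFunction.moebius n : ℝ) / n *
          (Real.eulerMascheroniConstant + Real.log (Real.log x / n)) := by
  have hlog := Real.log_nonneg hx
  rw [Ri_eq_one_add_tsum hlog,
    ← (summable_moebius_mul_ein hlog).sum_add_tsum_nat_add (⌊Real.log x⌋₊ + 1),
    Finset.range_eq_Ico, Finset.sum_eq_sum_Ico_succ_bot (Nat.succ_pos _)]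
  simp_rw [li_rpow_one_div x (by linarith), mul_add _ (_ + _) (ein _), Finset.sum_add_distrib]
  rw [show Finset.Ico (0 + 1) (⌊Real.log x⌋₊ + 1) = Finset.Icc 1 ⌊Real.log x⌋₊ from rfl]
  simp only [Nat.cast_zero, div_zero, zero_mul, zero_add]
  ring

/-- `Ri(x) = R(x) + O((log log x)²)` as `x → ∞`, where
`R(x) = ∑_{n ≤ log x} (μ(n)/n)·li(x^{1/n})`. -/
theorem Ri_eq_R_add_bigO :
    ∃ C x₀ : ℝ, Real.exp 1 < x₀ ∧ ∀ x ≥ x₀,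
      |Ri x - ∑ n ∈ Finset.Icc 1 ⌊Real.log x⌋₊,
          ((ArithmeticFunction.moebius n : ℝ) / n) * li (x ^ (1 / (n : ℝ)))|
        ≤ C * (Real.log (Real.log x)) ^ 2 := by
  refine ⟨5 + 2 * ein 1, Real.exp (Real.exp 1), ?_, fun x hx ↦ ?_⟩
  · exact Real.exp_lt_exp.mpr (by linarith [Real.add_one_lt_exp one_ne_zero])
  have hx0 : 0 < x := (Real.exp_pos _).trans_le hx
  have hL : Real.exp 1 ≤ Real.log x := (Real.le_log_iff_exp_le hx0).mpr hx
  have hL0 : 0 < Real.log x := (Real.exp_pos _).trans_le hL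
  have hL1 : 1 ≤ Real.log x := by linarith [Real.add_one_lt_exp one_ne_zero]
  have hx1 : 1 ≤ x := by linarith [Real.log_le_sub_one_of_pos hx0]
  have hl : 1 ≤ Real.log (Real.log x) := (Real.le_log_iff_exp_le hL0).mpr hL
  have htail := abs_tsum_moebius_mul_ein_tail_le hL0.le
  have hmain := abs_sum_moebius_div_mul_log_le hL1
  rw [Ri_sub_sum_moebius_mul_li_eq hx1]
  calc _ ≤ 1 + 2 * ein 1 + (1 + Real.log (Real.log x)) ^ 2 := by
        refine (abs_sub _ _).trans (add_le_add ((abs_add_le _ _).trans ?_) hmain)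
        rw [abs_one]
        gcongr
    _ ≤ _ := by
        have hsq : 1 ≤ Real.log (Real.log x) ^ 2 := one_le_pow₀ hl
        nlinarith [mul_nonneg (ein_nonneg zero_le_one) (sub_nonneg.mpr hsq)]
end

section
/- One has li(x) − Ri(x) ∼ (1/2)·li(√x) ∼ √x/log x as x → ∞, and moreover li(x) − Ri(x) − (1/2)·li(√x) ∼ (1/3)·li(x^{1/3}) ∼ x^{1/3}/log x as x → ∞. -/
open Filter

open Topology

/-- The entire part `∑_{k≥1} t^k/(k·k!)` of the exponential integral. -/
noncomputable def einSeries (t : ℝ) : ℝ :=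
  ∑' k : ℕ, t ^ (k + 1) / (((k : ℝ) + 1) * (Nat.factorial (k + 1) : ℝ))

lemma summable_einSeries (t : ℝ) :
    Summable fun k : ℕ => t ^ (k + 1) / (((k : ℝ) + 1) * (Nat.factorial (k + 1) : ℝ)) := by
  have h := (summable_nat_add_iff 1).2 (Real.summable_pow_div_factorial |t|)
  refine Summable.of_norm_bounded h fun k => ?_
  have hf : (0 : ℝ) < (Nat.factorial (k + 1) : ℝ) := by positivity
  rw [Real.norm_eq_abs, abs_div, abs_pow, abs_of_pos (by positivity : (0 : ℝ) < _ * _)]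
  refine div_le_div_of_nonneg_left (by positivity) hf ?_
  nlinarith [(Nat.cast_nonneg k : (0 : ℝ) ≤ k)]

lemma einSeries_nonneg {t : ℝ} (ht : 0 ≤ t) : 0 ≤ einSeries t :=
  tsum_nonneg fun k => by positivity

lemma exp_eq_tsum_pow_div_factorial (t : ℝ) : Real.exp t = ∑' n : ℕ, t ^ n / (n.factorial : ℝ) := by
  rw [Real.exp_eq_exp_ℝ, NormedSpace.exp_eq_tsum_div]

lemma tsum_nat_add_pow_div_factorial (t : ℝ) (m : ℕ) :
    ∑' n : ℕ, t ^ (n + m) / ((n + m).factorial : ℝ)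
      = Real.exp t - ∑ i ∈ Finset.range m, t ^ i / (i.factorial : ℝ) := by
  rw [exp_eq_tsum_pow_div_factorial,
    ← (Real.summable_pow_div_factorial t).sum_add_tsum_nat_add m]
  ring

lemma le_mul_einSeries {t : ℝ} (ht : 0 ≤ t) : Real.exp t - 1 - t ≤ t * einSeries t := by
  have h : Real.exp t - 1 - t = ∑' n : ℕ, t ^ (n + 2) / ((n + 2).factorial : ℝ) := by
    rw [tsum_nat_add_pow_div_factorial]
    simp [Finset.sum_range_succ]
    ring
  rw [h, einSeries, ← tsum_mul_left]
  refine Summable.tsum_le_tsum (fun k => ?_)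
    ((summable_nat_add_iff 2).2 (Real.summable_pow_div_factorial t))
    ((summable_einSeries t).mul_left t)
  have hk : (0 : ℝ) ≤ k := Nat.cast_nonneg k
  have hf : (0 : ℝ) < (Nat.factorial (k + 1) : ℝ) := by positivity
  rw [← mul_div_assoc, ← pow_succ', Nat.factorial_succ (k + 1)]
  push_cast
  refine div_le_div_of_nonneg_left (by positivity) (by positivity) ?_
  nlinarith

lemma sq_mul_einSeries_le {t : ℝ} (ht : 0 ≤ t) :
    t ^ 2 * einSeries t ≤ t * Real.exp t + 3 * Real.exp t := by
  have s2 := (summable_nat_add_iff 2).2 (Real.summable_pow_div_factorial t)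
  have s3 := (summable_nat_add_iff 3).2 (Real.summable_pow_div_factorial t)
  have tail (m : ℕ) : ∑' n : ℕ, t ^ (n + m) / ((n + m).factorial : ℝ) ≤ Real.exp t := by
    rw [tsum_nat_add_pow_div_factorial]
    exact sub_le_self _ (Finset.sum_nonneg fun i _ => by positivity)
  calc t ^ 2 * einSeries t
      ≤ ∑' k : ℕ, (t * (t ^ (k + 2) / ((k + 2).factorial : ℝ))
          + 3 * (t ^ (k + 3) / ((k + 3).factorial : ℝ))) := by
        rw [einSeries, ← tsum_mul_left]
        refine Summable.tsum_le_tsum (fun k => ?_) ((summable_einSeries t).mul_left _)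
          ((s2.mul_left t).add (s3.mul_left 3))
        have hk : (0 : ℝ) ≤ k := Nat.cast_nonneg k
        have hf : (0 : ℝ) < (Nat.factorial (k + 1) : ℝ) := by positivity
        rw [Nat.factorial_succ (k + 2), Nat.factorial_succ (k + 1)]
        push_cast
        have e1 : t ^ 2 * (t ^ (k + 1) / (((k : ℝ) + 1) * (Nat.factorial (k + 1) : ℝ)))
            = t ^ (k + 3) / (Nat.factorial (k + 1) : ℝ) * (1 / ((k : ℝ) + 1)) := by
          field_simp
          ring
        have e2 : t * (t ^ (k + 2) / (((k : ℝ) + 1 + 1) * (Nat.factorial (k + 1) : ℝ)))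
              + 3 * (t ^ (k + 3) / (((k : ℝ) + 2 + 1)
                * (((k : ℝ) + 1 + 1) * (Nat.factorial (k + 1) : ℝ))))
            = t ^ (k + 3) / (Nat.factorial (k + 1) : ℝ)
              * (1 / ((k : ℝ) + 2) + 3 / (((k : ℝ) + 3) * ((k : ℝ) + 2))) := by
          have h2 : (k : ℝ) + 1 + 1 = k + 2 := by ring
          have h3 : (k : ℝ) + 2 + 1 = k + 3 := by ring
          rw [h2, h3]
          field_simp
          ring
        rw [e1, e2]
        refine mul_le_mul_of_nonneg_left ?_ (by positivity)
        rw [div_add_div _ _ (by positivity) (by positivity),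
          div_le_div_iff₀ (by positivity) (by positivity)]
        nlinarith [mul_nonneg hk hk]
    _ ≤ t * Real.exp t + 3 * Real.exp t := by
        rw [(s2.mul_left t).tsum_add (s3.mul_left 3), tsum_mul_left, tsum_mul_left]
        gcongr
        · exact tail 2
        · exact tail 3

lemma tendsto_pow_div_exp (n : ℕ) : Tendsto (fun t : ℝ => t ^ n / Real.exp t) atTop (𝓝 0) := by
  simpa [Real.exp_neg, div_eq_mul_inv] using Real.tendsto_pow_mul_exp_neg_atTop_nhds_zero n

/-- `∑_{k≥1} t^k/(k·k!) ∼ e^t/t` as `t → ∞`. -/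
lemma tendsto_einSeries_div :
    Tendsto (fun t : ℝ => einSeries t / (Real.exp t / t)) atTop (𝓝 1) := by
  have hl : Tendsto (fun t : ℝ => 1 - t ^ 0 / Real.exp t - t ^ 1 / Real.exp t) atTop (𝓝 1) := by
    simpa only [sub_zero] using
      (tendsto_const_nhds.sub (tendsto_pow_div_exp 0)).sub (tendsto_pow_div_exp 1)
  have hu : Tendsto (fun t : ℝ => 1 + 3 / t) atTop (𝓝 1) := by
    simpa using (tendsto_const_nhds (x := (1 : ℝ))).add
      (tendsto_const_nhds.div_atTop (a := (3 : ℝ)) tendsto_id)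
  refine tendsto_of_tendsto_of_tendsto_of_le_of_le' hl hu ?_ ?_
  · filter_upwards [eventually_gt_atTop 0] with t ht
    have h := le_mul_einSeries ht.le
    have he := Real.exp_pos t
    calc 1 - t ^ 0 / Real.exp t - t ^ 1 / Real.exp t
        = (Real.exp t - 1 - t) / Real.exp t := by field_simp
      _ ≤ t * einSeries t / Real.exp t := by gcongr
      _ = _ := by field_simp
  · filter_upwards [eventually_gt_atTop 0] with t ht
    have h := sq_mul_einSeries_le ht.le
    have he := Real.exp_pos t
    calc einSeries t / (Real.exp t / t)
        = t ^ 2 * einSeries t / (t * Real.exp t) := by field_simp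
      _ ≤ (t * Real.exp t + 3 * Real.exp t) / (t * Real.exp t) := by gcongr
      _ = 1 + 3 / t := by field_simp

lemma li_exp (t : ℝ) :
    li (Real.exp t) = Real.eulerMascheroniConstant + Real.log t + einSeries t := by
  simp only [li, einSeries, Real.log_exp]

lemma tendsto_log_mul_exp_neg_div {c : ℝ} (hc : 0 < c) :
    Tendsto (fun t : ℝ => Real.log t / (Real.exp (c * t) / t)) atTop (𝓝 0) := by
  have h := (tendsto_pow_div_exp 2).comp (tendsto_id.const_mul_atTop hc)
  have h' := h.const_mul ((c ^ 2)⁻¹)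
  rw [mul_zero] at h'
  refine squeeze_zero_norm' ?_ h'
  filter_upwards [eventually_ge_atTop 1] with t ht
  have h0 := Real.log_nonneg ht
  have h1 : Real.log t ≤ t := (Real.log_le_sub_one_of_pos (by linarith)).trans (by linarith)
  have ht0 : 0 < t := by linarith
  rw [Real.norm_of_nonneg (by positivity)]
  simp only [Function.comp, id]
  calc Real.log t / (Real.exp (c * t) / t) ≤ t / (Real.exp (c * t) / t) := by gcongr
    _ = _ := by field_simp

lemma tendsto_const_div_exp_div {c : ℝ} (hc : 0 < c) (A : ℝ) :
    Tendsto (fun t : ℝ => A / (Real.exp (c * t) / t)) atTop (𝓝 0) := by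
  have h := ((tendsto_pow_div_exp 1).comp (tendsto_id.const_mul_atTop hc)).const_mul (A / c)
  rw [mul_zero] at h
  refine h.congr' ?_
  filter_upwards [eventually_gt_atTop 0] with t ht
  simp only [Function.comp, id]
  field_simp

/-- `li(y) ∼ y / log y` in the variable `t = log y`. -/
lemma tendsto_li_exp_div :
    Tendsto (fun t : ℝ => li (Real.exp t) / (Real.exp t / t)) atTop (𝓝 1) := by
  have h1 := tendsto_const_div_exp_div one_pos Real.eulerMascheroniConstant
  have h2 := tendsto_log_mul_exp_neg_div one_pos
  simp only [one_mul] at h1 h2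
  simpa only [li_exp, add_div, zero_add] using (h1.add h2).add tendsto_einSeries_div

lemma tendsto_mul_li_exp_mul_div {c : ℝ} (hc : 0 < c) :
    Tendsto (fun t : ℝ => c * li (Real.exp (c * t)) / (Real.exp (c * t) / t)) atTop (𝓝 1) := by
  refine (tendsto_li_exp_div.comp (tendsto_id.const_mul_atTop hc)).congr' ?_
  filter_upwards [eventually_gt_atTop 0] with t ht
  simp only [Function.comp, id]
  field_simp

lemma summable_realZeta {k : ℕ} (hk : 2 ≤ k) :
    Summable fun n : ℕ => 1 / ((n : ℝ) + 1) ^ k := by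
  simpa using (summable_nat_add_iff 1).2 (Real.summable_one_div_nat_pow.2 (by omega : 1 < k))

/-- `1/ζ(k) = 1 - 2^{-k} - 3^{-k} + O(4^{-k})` for `k ≥ 2`. -/
lemma exists_abs_one_sub_inv_realZeta_sub_le :
    ∃ C : ℝ, 0 ≤ C ∧ ∀ k : ℕ, 2 ≤ k → 1 ≤ realZeta k ∧
      |1 - 1 / realZeta k - (1 / 2) ^ k - (1 / 3) ^ k| ≤ C * (1 / 4) ^ k := by
  set C₀ : ℝ := ∑' n : ℕ, 16 * (1 / (((n + 3 : ℕ) : ℝ) + 1) ^ 2) with hC₀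
  have hs₀ : Summable fun n : ℕ => 16 * (1 / (((n + 3 : ℕ) : ℝ) + 1) ^ 2) :=
    ((summable_nat_add_iff 3).2 (summable_realZeta le_rfl)).mul_left 16
  have hC₀0 : 0 ≤ C₀ := tsum_nonneg fun n => by positivity
  refine ⟨4 + 2 * C₀, by positivity, fun k hk => ?_⟩
  have hs := summable_realZeta hk
  set c : ℝ := ∑' n : ℕ, 1 / (((n + 3 : ℕ) : ℝ) + 1) ^ k with hc
  have hc0 : 0 ≤ c := tsum_nonneg fun n => by positivity
  have hcle : c ≤ C₀ * (1 / 4) ^ k := by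
    rw [hc, hC₀, ← tsum_mul_right]
    refine Summable.tsum_le_tsum (fun n => ?_) ((summable_nat_add_iff 3).2 hs) (hs₀.mul_right _)
    have hn : (0 : ℝ) ≤ n := Nat.cast_nonneg n
    have hy : (0 : ℝ) < ((n + 3 : ℕ) : ℝ) + 1 := by positivity
    have h4 : 4 / (((n + 3 : ℕ) : ℝ) + 1) ≤ 1 := by
      rw [div_le_one hy]; push_cast; linarith
    have h := pow_le_pow_of_le_one (by positivity) h4 hk
    calc 1 / (((n + 3 : ℕ) : ℝ) + 1) ^ k
        = (4 / (((n + 3 : ℕ) : ℝ) + 1)) ^ k * (1 / 4) ^ k := by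
          rw [← mul_pow, ← one_div_pow]; congr 1; field_simp
      _ ≤ (4 / (((n + 3 : ℕ) : ℝ) + 1)) ^ 2 * (1 / 4) ^ k := by gcongr
      _ = _ := by rw [div_pow]; ring
  have hz : realZeta k = 1 + (1 / 2) ^ k + (1 / 3) ^ k + c := by
    rw [realZeta, ← hs.sum_add_tsum_nat_add 3, hc]
    norm_num [Finset.sum_range_succ, div_pow]
  set a : ℝ := (1 / 2) ^ k with ha
  set b : ℝ := (1 / 3) ^ k with hb
  have ha0 : 0 ≤ a := by positivity
  have hb0 : 0 ≤ b := by positivity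
  have hba : b ≤ a := pow_le_pow_left₀ (by norm_num) (by norm_num) k
  have haq : a * a = (1 / 4) ^ k := by rw [ha, ← mul_pow]; norm_num
  have ha2 : a ≤ 1 / 2 ^ 1 := by
    rw [ha, ← one_div_pow]
    exact pow_le_pow_of_le_one (by norm_num) (by norm_num) (by omega)
  have hz1 : 1 ≤ realZeta k := by rw [hz]; linarith
  refine ⟨hz1, ?_⟩
  have hz0 : realZeta k ≠ 0 := by positivity
  have e : 1 - 1 / realZeta k - a - b = (c - (a + b) * (a + b + c)) / realZeta k := by
    field_simp
    rw [hz]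
    ring
  rw [e, abs_div, abs_of_pos (by positivity : 0 < realZeta k)]
  refine (div_le_self (abs_nonneg _) hz1).trans ?_
  have h2 : (a + b) * (a + b + c) ≤ 4 * (a * a) + c := by nlinarith
  have h3 : 0 ≤ (a + b) * (a + b + c) := by positivity
  rw [abs_le]
  constructor <;> nlinarith

/-- `li - Ri` minus the first two terms of its Möbius expansion, up to `O(∑ (t/4)^k/(k·k!))`. -/
lemma exists_abs_li_sub_Ri_exp_sub_le :
    ∃ C : ℝ, ∀ t : ℝ, 0 < t →
      |li (Real.exp t) - Ri (Real.exp t) - (Real.eulerMascheroniConstant + Real.log t - 1)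
        - 1 / 2 * einSeries (1 / 2 * t) - 1 / 3 * einSeries (1 / 3 * t)|
      ≤ C * einSeries (1 / 4 * t) := by
  obtain ⟨C, hC, h⟩ := exists_abs_one_sub_inv_realZeta_sub_le
  refine ⟨C, fun t ht => ?_⟩
  set w : ℕ → ℝ := fun k => t ^ (k + 1) / (((k : ℝ) + 1) * (Nat.factorial (k + 1) : ℝ)) with hw
  have hw0 (k : ℕ) : 0 ≤ w k := by positivity
  have hwc (c : ℝ) (k : ℕ) :
      (c * t) ^ (k + 1) / (((k : ℝ) + 1) * (Nat.factorial (k + 1) : ℝ)) = c ^ (k + 1) * w k := by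
    rw [mul_pow, mul_div_assoc]
  have hsc (c : ℝ) : HasSum (fun k => c ^ (k + 1) * w k) (einSeries (c * t)) := by
    simp only [← hwc]
    exact (summable_einSeries (c * t)).hasSum
  have hs1 : HasSum w (einSeries t) := (summable_einSeries t).hasSum
  have hsR : HasSum (fun k => w k * (1 / realZeta (k + 2))) (Ri (Real.exp t) - 1) := by
    have hsum : Summable fun k => w k * (1 / realZeta (k + 2)) := by
      refine Summable.of_nonneg_of_le (fun k => ?_) (fun k => ?_) hs1.summable
      · have := (h (k + 2) (by omega)).1
        exact mul_nonneg (hw0 k) (by positivity)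
      · have := (h (k + 2) (by omega)).1
        exact mul_le_of_le_one_right (hw0 k) ((div_le_one (by positivity)).2 this)
    have e : Ri (Real.exp t) - 1 = ∑' k, w k * (1 / realZeta (k + 2)) := by
      simp only [Ri, Real.log_exp, add_sub_cancel_left, hw, div_mul_div_comm, mul_one]
    rw [e]
    exact hsum.hasSum
  have hD := ((hs1.sub hsR).sub ((hsc (1 / 2)).mul_left (1 / 2))).sub
    ((hsc (1 / 3)).mul_left (1 / 3))
  have e : li (Real.exp t) - Ri (Real.exp t) - (Real.eulerMascheroniConstant + Real.log t - 1)
        - 1 / 2 * einSeries (1 / 2 * t) - 1 / 3 * einSeries (1 / 3 * t)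
      = einSeries t - (Ri (Real.exp t) - 1)
        - 1 / 2 * einSeries (1 / 2 * t) - 1 / 3 * einSeries (1 / 3 * t) := by
    rw [li_exp]; ring
  rw [e, ← hD.tsum_eq, ← Real.norm_eq_abs]
  refine tsum_of_norm_bounded ((hsc (1 / 4)).mul_left C) fun k => ?_
  have hk := (h (k + 2) (by omega)).2
  have e' : w k - w k * (1 / realZeta (k + 2)) - 1 / 2 * ((1 / 2) ^ (k + 1) * w k)
        - 1 / 3 * ((1 / 3) ^ (k + 1) * w k)
      = w k * (1 - 1 / realZeta (k + 2) - (1 / 2) ^ (k + 2) - (1 / 3) ^ (k + 2)) := by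
    ring
  rw [e', Real.norm_eq_abs, abs_mul, abs_of_nonneg (hw0 k)]
  have hq : ((1 : ℝ) / 4) ^ (k + 2) ≤ (1 / 4) ^ (k + 1) :=
    pow_le_pow_of_le_one (by norm_num) (by norm_num) (by omega)
  calc w k * |1 - 1 / realZeta (k + 2) - (1 / 2) ^ (k + 2) - (1 / 3) ^ (k + 2)|
      ≤ w k * (C * (1 / 4) ^ (k + 1)) :=
        mul_le_mul_of_nonneg_left (hk.trans (by gcongr)) (hw0 k)
    _ = _ := by ring

lemma tendsto_exp_div_ratio {a b : ℝ} (hab : a < b) :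
    Tendsto (fun t : ℝ => (Real.exp (a * t) / t) / (Real.exp (b * t) / t)) atTop (𝓝 0) := by
  have h := Real.tendsto_exp_neg_atTop_nhds_zero.comp
    (tendsto_id.const_mul_atTop (sub_pos.2 hab))
  refine h.congr' ?_
  filter_upwards [eventually_gt_atTop 0] with t ht
  simp only [Function.comp, id]
  rw [div_div_div_cancel_right₀ ht.ne', ← Real.exp_sub]
  congr 1
  ring

lemma tendsto_li_sub_Ri_exp_remainder :
    Tendsto (fun t : ℝ => (li (Real.exp t) - Ri (Real.exp t)
        - 1 / 2 * li (Real.exp (1 / 2 * t)) - 1 / 3 * li (Real.exp (1 / 3 * t)))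
        / (Real.exp (1 / 3 * t) / t)) atTop (𝓝 0) := by
  obtain ⟨C, hC⟩ := exists_abs_li_sub_Ri_exp_sub_le
  set R : ℝ → ℝ := fun t => li (Real.exp t) - Ri (Real.exp t)
    - (Real.eulerMascheroniConstant + Real.log t - 1)
    - 1 / 2 * einSeries (1 / 2 * t) - 1 / 3 * einSeries (1 / 3 * t) with hR
  have hR0 : Tendsto (fun t => R t / (Real.exp (1 / 3 * t) / t)) atTop (𝓝 0) := by
    have h1 := tendsto_einSeries_div.comp
      (tendsto_id.const_mul_atTop (by norm_num : (0 : ℝ) < 1 / 4))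
    have h2 := (h1.mul (tendsto_exp_div_ratio (by norm_num : (1 : ℝ) / 4 < 1 / 3))).const_mul
      (4 * C)
    rw [mul_zero, mul_zero] at h2
    refine squeeze_zero_norm' ?_ h2
    filter_upwards [eventually_gt_atTop 0] with t ht
    rw [norm_div, Real.norm_of_nonneg (by positivity : 0 ≤ Real.exp (1 / 3 * t) / t),
      Real.norm_eq_abs]
    calc |R t| / (Real.exp (1 / 3 * t) / t)
        ≤ C * einSeries (1 / 4 * t) / (Real.exp (1 / 3 * t) / t) := by
          gcongr
          exact hC t ht
      _ = _ := by
          simp only [Function.comp, id]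
          field_simp
  have hc := tendsto_const_div_exp_div (by norm_num : (0 : ℝ) < 1 / 3)
    (1 / 6 * Real.eulerMascheroniConstant - 1 - 1 / 2 * Real.log (1 / 2)
      - 1 / 3 * Real.log (1 / 3))
  have hlog := (tendsto_log_mul_exp_neg_div (by norm_num : (0 : ℝ) < 1 / 3)).const_mul (1 / 6)
  have h := (hR0.add hc).add hlog
  rw [mul_zero, add_zero, add_zero] at h
  refine h.congr' ?_
  filter_upwards [eventually_gt_atTop 0] with t ht
  rw [← mul_div_assoc, ← add_div, ← add_div]
  congr 1
  simp only [hR, li_exp (1 / 2 * t), li_exp (1 / 3 * t)]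
  rw [Real.log_mul (by norm_num) ht.ne', Real.log_mul (by norm_num) ht.ne']
  ring

lemma tendsto_li_sub_Ri_exp_sub_div :
    Tendsto (fun t : ℝ => (li (Real.exp t) - Ri (Real.exp t)
        - 1 / 2 * li (Real.exp (1 / 2 * t))) / (Real.exp (1 / 3 * t) / t)) atTop (𝓝 1) := by
  have h := tendsto_li_sub_Ri_exp_remainder.add
    (tendsto_mul_li_exp_mul_div (by norm_num : (0 : ℝ) < 1 / 3))
  rw [zero_add] at h
  refine h.congr fun t => ?_
  rw [← add_div, sub_add_cancel]

lemma tendsto_li_sub_Ri_exp_div :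
    Tendsto (fun t : ℝ => (li (Real.exp t) - Ri (Real.exp t)) / (Real.exp (1 / 2 * t) / t))
      atTop (𝓝 1) := by
  have h := (tendsto_li_sub_Ri_exp_sub_div.mul
    (tendsto_exp_div_ratio (by norm_num : (1 : ℝ) / 3 < 1 / 2))).add
    (tendsto_mul_li_exp_mul_div (by norm_num : (0 : ℝ) < 1 / 2))
  rw [mul_zero, zero_add] at h
  refine h.congr' ?_
  filter_upwards [eventually_gt_atTop 0] with t ht
  rw [div_mul_div_cancel₀ (by positivity), ← add_div, sub_add_cancel]

lemma tendsto_div_of_tendsto_div {f g h : ℝ → ℝ} (hf : Tendsto (fun t => f t / h t) atTop (𝓝 1))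
    (hg : Tendsto (fun t => g t / h t) atTop (𝓝 1)) (hh : ∀ᶠ t in atTop, h t ≠ 0) :
    Tendsto (fun t => f t / g t) atTop (𝓝 1) := by
  have := hf.div hg one_ne_zero
  rw [div_one] at this
  refine this.congr' ?_
  filter_upwards [hh] with t ht
  exact div_div_div_cancel_right₀ ht _ _

/-- `li(x) − Ri(x) ∼ (1/2)·li(√x) ∼ √x/log x` and
`li(x) − Ri(x) − (1/2)·li(√x) ∼ (1/3)·li(x^{1/3}) ∼ x^{1/3}/log x` as `x → ∞`. -/
theorem li_sub_Ri_asymptotics :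
    Tendsto (fun x : ℝ =>
        (li x - Ri x) / ((1 / 2) * li (x ^ ((1 : ℝ) / 2)))) atTop (nhds 1) ∧
    Tendsto (fun x : ℝ =>
        ((1 / 2) * li (x ^ ((1 : ℝ) / 2))) / (Real.sqrt x / Real.log x)) atTop (nhds 1) ∧
    Tendsto (fun x : ℝ =>
        (li x - Ri x - (1 / 2) * li (x ^ ((1 : ℝ) / 2)))
          / ((1 / 3) * li (x ^ ((1 : ℝ) / 3)))) atTop (nhds 1) ∧
    Tendsto (fun x : ℝ =>
        ((1 / 3) * li (x ^ ((1 : ℝ) / 3))) / (x ^ ((1 : ℝ) / 3) / Real.log x)) atTop (nhds 1) := by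
  have hne (c : ℝ) : ∀ᶠ t : ℝ in atTop, Real.exp (c * t) / t ≠ 0 := by
    filter_upwards [eventually_gt_atTop 0] with t ht
    positivity
  have hrpow (c : ℝ) : ∀ᶠ x : ℝ in atTop, Real.exp (c * Real.log x) = x ^ c := by
    filter_upwards [eventually_gt_atTop 0] with x hx
    rw [Real.rpow_def_of_pos hx, mul_comm]
  have hexp : ∀ᶠ x : ℝ in atTop, Real.exp (Real.log x) = x := by
    filter_upwards [eventually_gt_atTop 0] with x hx
    exact Real.exp_log hx
  have l2 := tendsto_mul_li_exp_mul_div (by norm_num : (0 : ℝ) < 1 / 2)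
  have l3 := tendsto_mul_li_exp_mul_div (by norm_num : (0 : ℝ) < 1 / 3)
  have d2 := tendsto_div_of_tendsto_div tendsto_li_sub_Ri_exp_div l2 (hne _)
  have d3 := tendsto_div_of_tendsto_div tendsto_li_sub_Ri_exp_sub_div l3 (hne _)
  refine ⟨(d2.comp Real.tendsto_log_atTop).congr' ?_, (l2.comp Real.tendsto_log_atTop).congr' ?_,
    (d3.comp Real.tendsto_log_atTop).congr' ?_, (l3.comp Real.tendsto_log_atTop).congr' ?_⟩ <;>
  · filter_upwards [hexp, hrpow (1 / 2), hrpow (1 / 3)] with x h1 h2 h3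
    simp only [Function.comp, h1, h2, h3, Real.sqrt_eq_rpow]
end

section
/- For every integer N ≥ 1, one has li(x) − ∑_{n=1}^{N} (1/n)·Ri(x^{1/n}) ∼ (1/(N+1))·Ri(x^{1/(N+1)}) as x → ∞; that is, li(x) has the (divergent) asymptotic expansion li(x) ∼ ∑_{n=1}^∞ (1/n)·Ri(x^{1/n}) as x → ∞ (even though the series ∑_{n=1}^∞ (1/n)·Ri(x^{1/n}) diverges for every fixed x > 0). -/
open Filter

/-- The tail `∑_{n > N} 1/n^k` of the zeta series. -/
noncomputable def zetaTail (N k : ℕ) : ℝ := ∑' n : ℕ, 1 / ((n : ℝ) + N + 1) ^ k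

theorem summable_zetaTail (N k : ℕ) :
    Summable fun n : ℕ => 1 / ((n : ℝ) + N + 1) ^ (k + 2) := by
  have h := (Real.summable_one_div_nat_pow (p := k + 2)).2 (by omega)
  refine ((summable_nat_add_iff (N + 1)).2 h).congr fun n => ?_
  push_cast
  rw [add_assoc]

theorem zetaTail_zero (k : ℕ) : zetaTail 0 k = realZeta k := by
  simp [zetaTail, realZeta]

theorem zetaTail_eq_add_zetaTail_succ (N k : ℕ) :
    zetaTail N (k + 2) = 1 / ((N : ℝ) + 1) ^ (k + 2) + zetaTail (N + 1) (k + 2) := by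
  rw [zetaTail, (summable_zetaTail N k).tsum_eq_zero_add, zetaTail]
  congr 1
  · simp
  · refine tsum_congr fun n => ?_
    push_cast
    ring_nf

theorem zetaTail_nonneg (N k : ℕ) : 0 ≤ zetaTail N k :=
  tsum_nonneg fun n => by positivity

theorem zetaTail_le (N k : ℕ) : zetaTail N (k + 2) ≤ realZeta 2 / ((N : ℝ) + 1) ^ k := by
  have h := summable_zetaTail 0 0
  rw [← zetaTail_zero, zetaTail, zetaTail, ← tsum_div_const]
  refine (summable_zetaTail N k).tsum_le_tsum (fun n => ?_) (h.div_const _)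
  rw [div_div]
  refine one_div_le_one_div_of_le (by positivity) ?_
  rw [pow_add, mul_comm]
  gcongr <;> linarith [(n.cast_nonneg : (0 : ℝ) ≤ n), (N.cast_nonneg : (0 : ℝ) ≤ N)]

theorem one_le_realZeta (k : ℕ) : 1 ≤ realZeta (k + 2) := by
  rw [← zetaTail_zero, zetaTail_eq_add_zetaTail_succ]
  simpa using zetaTail_nonneg 1 (k + 2)

theorem realZeta_le (k : ℕ) : realZeta (k + 2) ≤ realZeta 2 := by
  simpa [zetaTail_zero] using zetaTail_le 0 k

/-- The terms of the Gram series, weighted by tails of the zeta series. -/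
noncomputable def gramTailTerm (N : ℕ) (t : ℝ) (k : ℕ) : ℝ :=
  t ^ (k + 1) / (((k : ℝ) + 1) * (Nat.factorial (k + 1) : ℝ) * realZeta (k + 2)) *
    zetaTail N (k + 2)

theorem gramTailTerm_nonneg (N : ℕ) {t : ℝ} (ht : 0 ≤ t) (k : ℕ) : 0 ≤ gramTailTerm N t k := by
  have := one_le_realZeta k
  have := zetaTail_nonneg N (k + 2)
  unfold gramTailTerm
  positivity

theorem gram_denom_ge (k : ℕ) :
    (Nat.factorial (k + 1) : ℝ) ≤
      ((k : ℝ) + 1) * (Nat.factorial (k + 1) : ℝ) * realZeta (k + 2) := by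
  have h1 := one_le_realZeta k
  have h2 : (1 : ℝ) ≤ (k : ℝ) + 1 := by linarith [(k.cast_nonneg : (0 : ℝ) ≤ k)]
  have h3 : (0 : ℝ) < (Nat.factorial (k + 1) : ℝ) := by positivity
  nlinarith [mul_le_mul h2 h1 zero_le_one (by linarith)]

theorem gramTailTerm_le (N : ℕ) {t : ℝ} (ht : 0 ≤ t) (k : ℕ) :
    gramTailTerm N t k ≤
      ((N : ℝ) + 1) * realZeta 2 * ((t / ((N : ℝ) + 1)) ^ (k + 1) / (Nat.factorial (k + 1) : ℝ)) := by
  calc gramTailTerm N t k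
      ≤ t ^ (k + 1) / (Nat.factorial (k + 1) : ℝ) * (realZeta 2 / ((N : ℝ) + 1) ^ k) := by
        unfold gramTailTerm
        gcongr
        · exact zetaTail_nonneg _ _
        · exact gram_denom_ge k
        · exact zetaTail_le N k
    _ = _ := by
        rw [div_pow]
        field_simp
        ring

theorem hasSum_exp_sub_one (s : ℝ) :
    HasSum (fun k : ℕ => s ^ (k + 1) / (Nat.factorial (k + 1) : ℝ)) (Real.exp s - 1) := by
  have h : HasSum (fun k : ℕ => s ^ k / (Nat.factorial k : ℝ)) (Real.exp s) := by
    rw [Real.exp_eq_exp_ℝ]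
    exact NormedSpace.expSeries_div_hasSum_exp s
  simpa using (hasSum_nat_add_iff' 1).2 h

theorem summable_gramTailTerm (N : ℕ) {t : ℝ} (ht : 0 ≤ t) : Summable (gramTailTerm N t) :=
  .of_nonneg_of_le (gramTailTerm_nonneg N ht) (gramTailTerm_le N ht)
    ((hasSum_exp_sub_one _).summable.mul_left _)

theorem tsum_gramTailTerm_le (N : ℕ) {t : ℝ} (ht : 0 ≤ t) :
    ∑' k, gramTailTerm N t k ≤
      ((N : ℝ) + 1) * realZeta 2 * Real.exp (t / ((N : ℝ) + 1)) := by
  have h := hasSum_exp_sub_one (t / ((N : ℝ) + 1))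
  have h1 := (summable_gramTailTerm N ht).tsum_le_tsum (gramTailTerm_le N ht)
    (h.summable.mul_left _)
  rw [tsum_mul_left, h.tsum_eq] at h1
  have := one_le_realZeta 0
  refine h1.trans ?_
  simp only [zero_add] at this
  gcongr
  linarith

theorem summable_gram {s : ℝ} (hs : 0 ≤ s) :
    Summable fun k : ℕ =>
      s ^ (k + 1) / (((k : ℝ) + 1) * (Nat.factorial (k + 1) : ℝ) * realZeta (k + 2)) := by
  refine .of_nonneg_of_le (fun k => ?_) (fun k => ?_) (hasSum_exp_sub_one s).summable
  · have := one_le_realZeta k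
    positivity
  · have := gram_denom_ge k
    gcongr

theorem exp_sub_one_le_Ri_exp {s : ℝ} (hs : 0 ≤ s) :
    Real.exp s - 1 ≤ s * realZeta 2 * Ri (Real.exp s) := by
  have hZ : 1 ≤ realZeta 2 := one_le_realZeta 0
  have h := hasSum_exp_sub_one s
  have h' := (summable_nat_add_iff 1).2 h.summable
  have key : ∑' k : ℕ, s ^ (k + 1 + 1) / (Nat.factorial (k + 1 + 1) : ℝ) ≤
      s * realZeta 2 * ∑' k : ℕ,
        s ^ (k + 1) / (((k : ℝ) + 1) * (Nat.factorial (k + 1) : ℝ) * realZeta (k + 2)) := by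
    rw [← tsum_mul_left]
    refine h'.tsum_le_tsum (fun k => ?_) ((summable_gram hs).mul_left _)
    have h1 := realZeta_le k
    have h2 := one_le_realZeta k
    rw [← mul_div_assoc, div_le_div_iff₀ (by positivity) (by positivity), Nat.factorial_succ (k + 1)]
    push_cast
    calc s ^ (k + 1 + 1) * (((k : ℝ) + 1) * (Nat.factorial (k + 1) : ℝ) * realZeta (k + 2))
        ≤ s ^ (k + 1 + 1) * (((k : ℝ) + 1 + 1) * (Nat.factorial (k + 1) : ℝ) * realZeta 2) := by
          gcongr
          linarith
      _ = _ := by ring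
  rw [← h.tsum_eq, h.summable.tsum_eq_zero_add, Ri, Real.log_exp, mul_add]
  refine add_le_add ?_ key
  simp only [zero_add, pow_one, Nat.factorial_one, Nat.cast_one, div_one, mul_one]
  nlinarith

theorem li_exp_sub_sum_Ri (N : ℕ) {t : ℝ} (ht : 0 ≤ t) :
    li (Real.exp t) - ∑ n ∈ Finset.Icc 1 N, (1 / (n : ℝ)) * Ri (Real.exp (t / n)) =
      Real.eulerMascheroniConstant + Real.log t - ∑ n ∈ Finset.Icc 1 N, 1 / (n : ℝ) +
        ∑' k, gramTailTerm N t k := by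
  induction N with
  | zero =>
    simp only [zero_lt_one, Finset.Icc_eq_empty_of_lt, Finset.sum_empty, sub_zero, li,
      Real.log_exp, gramTailTerm, zetaTail_zero]
    congr 1
    refine tsum_congr fun k => ?_
    have := one_le_realZeta k
    have : realZeta (k + 2) ≠ 0 := by linarith
    field_simp
  | succ N ih =>
    rw [Finset.sum_Icc_succ_top (by omega), Finset.sum_Icc_succ_top (by omega), ← sub_sub, ih]
    have h : ∑' k, gramTailTerm N t k = (1 / ((N + 1 : ℕ) : ℝ)) * (∑' k : ℕ,
        (t / (N + 1 : ℕ)) ^ (k + 1) /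
          (((k : ℝ) + 1) * (Nat.factorial (k + 1) : ℝ) * realZeta (k + 2))) +
        ∑' k, gramTailTerm (N + 1) t k := by
      rw [← tsum_mul_left, ← ((summable_gram (by positivity)).mul_left _).tsum_add
        (summable_gramTailTerm _ ht)]
      refine tsum_congr fun k => ?_
      rw [gramTailTerm, zetaTail_eq_add_zetaTail_succ, mul_add, gramTailTerm]
      congr 1
      have := one_le_realZeta k
      have : realZeta (k + 2) ≠ 0 := by linarith
      push_cast
      rw [div_pow]
      field_simp
      ring
    rw [h, Ri, Real.log_exp]
    ring

theorem Ri_exp_pos {s : ℝ} (hs : 0 ≤ s) : 0 < Ri (Real.exp s) := by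
  have : 0 ≤ ∑' k : ℕ,
      s ^ (k + 1) / (((k : ℝ) + 1) * (Nat.factorial (k + 1) : ℝ) * realZeta (k + 2)) :=
    tsum_nonneg fun k => by
      have := one_le_realZeta k
      positivity
  rw [Ri, Real.log_exp]
  linarith

theorem tendsto_li_exp_sub_sum_Ri_div (N : ℕ) :
    Tendsto (fun t : ℝ =>
        (li (Real.exp t) -
            ∑ n ∈ Finset.Icc 1 (N + 1), (1 / (n : ℝ)) * Ri (Real.exp (t / n)))
          / ((1 / ((N : ℝ) + 1)) * Ri (Real.exp (t / ((N : ℝ) + 1)))))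
      atTop (nhds 0) := by
  set Z := realZeta 2
  have hZ : 1 ≤ Z := one_le_realZeta 0
  set M : ℝ := (N : ℝ) + 1 with hM
  have hM0 : 0 < M := by positivity
  set H : ℝ := ∑ n ∈ Finset.Icc 1 (N + 1), 1 / (n : ℝ)
  have hH : 0 ≤ H := Finset.sum_nonneg fun n _ => by positivity
  have hγ : 0 ≤ Real.eulerMascheroniConstant := by
    linarith [Real.one_half_lt_eulerMascheroniConstant]
  set K : ℝ := Real.eulerMascheroniConstant + H + 1 + (M + 1) * Z
  set δ : ℝ := 1 / M - 1 / (M + 1)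
  have hδ : 0 < δ := by
    have : 1 / (M + 1) < 1 / M := one_div_lt_one_div_of_lt hM0 (by linarith)
    simp only [δ]
    linarith
  have hlim : Tendsto (fun t : ℝ => (2 * K * Z) * (t ^ (2 : ℝ) * Real.exp (-δ * t))) atTop
      (nhds 0) := by
    simpa using (tendsto_rpow_mul_exp_neg_mul_atTop_nhds_zero 2 δ hδ).const_mul (2 * K * Z)
  refine squeeze_zero_norm' ?_ hlim
  filter_upwards [eventually_ge_atTop 1, eventually_ge_atTop M] with t ht1 htM
  have ht0 : 0 ≤ t := by linarith
  rw [li_exp_sub_sum_Ri _ ht0]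
  set s := t / M with hs
  have hs1 : 1 ≤ s := (one_le_div hM0).2 htM
  have hR := Ri_exp_pos (s := s) (by linarith)
  have hRs : Real.exp s ≤ 2 * (s * Z * Ri (Real.exp s)) := by
    have := exp_sub_one_le_Ri_exp (s := s) (by linarith)
    have := Real.add_one_le_exp s
    linarith
  set E := Real.exp (t / (M + 1)) with hE
  have hE1 : 1 ≤ E := Real.one_le_exp (by positivity)
  have hnum : |Real.eulerMascheroniConstant + Real.log t - H + ∑' k, gramTailTerm (N + 1) t k| ≤
      K * (t * E) := by
    have h1 := Real.log_nonneg ht1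
    have h2 := Real.log_le_sub_one_of_pos (by linarith : 0 < t)
    have h3 := tsum_gramTailTerm_le (N + 1) ht0
    have h4 : 0 ≤ ∑' k, gramTailTerm (N + 1) t k := tsum_nonneg (gramTailTerm_nonneg _ ht0)
    push_cast at h3
    rw [← hM, ← hE] at h3
    have h5 : t ≤ t * E := le_mul_of_one_le_right ht0 hE1
    have h6 : E ≤ t * E := le_mul_of_one_le_left (by linarith) ht1
    have h7 : 1 ≤ t * E := by linarith
    have h8 : (M + 1) * Z * E ≤ (M + 1) * Z * (t * E) := by gcongr
    have h9 : (Real.eulerMascheroniConstant + H) ≤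
        (Real.eulerMascheroniConstant + H) * (t * E) :=
      le_mul_of_one_le_right (by linarith) h7
    have h10 : K * (t * E) = (Real.eulerMascheroniConstant + H) * (t * E) + t * E +
        (M + 1) * Z * (t * E) := by
      simp only [K]
      ring
    rw [abs_le]
    constructor <;> linarith
  have hK : 0 ≤ K := by positivity
  rw [Real.norm_eq_abs, abs_div, abs_of_pos (a := 1 / M * Ri (Real.exp s)) (by positivity),
    div_le_iff₀ (by positivity)]
  refine hnum.trans ?_
  have hexp : E = Real.exp (-δ * t) * Real.exp s := by
    rw [hE, ← Real.exp_add]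
    congr 1
    simp only [δ, hs]
    ring
  rw [hexp, Real.rpow_two]
  calc K * (t * (Real.exp (-δ * t) * Real.exp s))
      ≤ K * (t * (Real.exp (-δ * t) * (2 * (s * Z * Ri (Real.exp s))))) := by gcongr
    _ = _ := by
      simp only [hs]
      ring

/-- For every integer `N ≥ 1`, one has
`li(x) − ∑_{n=1}^{N} (1/n)·Ri(x^{1/n}) ∼ (1/(N+1))·Ri(x^{1/(N+1)})` as `x → ∞`. -/
theorem li_divergent_asymptotic_expansion (N : ℕ) (hN : 1 ≤ N) :
    Tendsto (fun x : ℝ =>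
        (li x - ∑ n ∈ Finset.Icc 1 N, (1 / (n : ℝ)) * Ri (x ^ (1 / (n : ℝ))))
          / ((1 / ((N : ℝ) + 1)) * Ri (x ^ (1 / ((N : ℝ) + 1)))))
      atTop (nhds 1) := by
  have h := ((tendsto_li_exp_sub_sum_Ri_div N).comp Real.tendsto_log_atTop).const_add 1
  rw [add_zero] at h
  refine h.congr' ?_
  filter_upwards [eventually_ge_atTop 1] with x hx
  have hx0 : 0 < x := by linarith
  have hpow (a : ℝ) : Real.exp (Real.log x / a) = x ^ (1 / a) := by
    rw [Real.rpow_def_of_pos hx0, mul_one_div]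
  have hR := Ri_exp_pos (s := Real.log x / ((N : ℝ) + 1))
    (div_nonneg (Real.log_nonneg hx) (by positivity))
  rw [hpow] at hR
  simp only [Function.comp_apply, hpow, Real.exp_log hx0]
  rw [Finset.sum_Icc_succ_top (by omega)]
  push_cast
  field_simp
  ring
end
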